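/- Refined Cauchy identity for Schur polynomials in determinantal form (equations (6.9)–(6.10), the s_0 = 0 specialization of the main results). Let N ≥ 1, q ∈ (0,1), γ ∈ ℂ, let u_1,…,u_N be pairwise distinct and v_1,…,v_N be pairwise distinct complex numbers with |u_iv_j| < 1 for all 1 ≤ i,j ≤ N. Then the family indexed by λ ∈ Sign_N with terms ∏_{j=1}^N (1−γq^{λ_j+N−j+1}) · s_λ(u_1,…,u_N) · s_λ(v_1,…,v_N) is absolutely summable and Σ_{λ∈Sign_N} ∏_{j=1}^N (1−γq^{λ_j+N−j+1}) s_λ(u) s_λ(v) = det_{1≤i,j≤N}[ (1−q+q(1−γ)(1−u_iv_j)) / ((1−u_iv_j)(1−qu_iv_j)) ] / ∏_{1≤i<j≤N}(u_i−u_j)(v_i−v_j) = [1/∏_{1≤i<j≤N}(u_i−u_j)] · det_{1≤i,j≤N}[ u_j^{N−i} ( ∏_{l=1}^N (1−u_jv_l)^{−1} − γq^{N−i+1} ∏_{l=1}^N (1−qu_jv_l)^{−1} ) ]. -/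

import Mathlib

open scoped BigOperators

noncomputable section

/-- A (nonnegative) signature of length `N`: a weakly decreasing `N`-tuple of
nonnegative integers. -/
def Sign (N : ℕ) : Type :=
  {lam : Fin N → ℕ // ∀ i j : Fin N, i ≤ j → lam j ≤ lam i}

/-- The Vandermonde-type product `∏_{1 ≤ i < j ≤ N} (w i − w j)`. -/
def vandP {N : ℕ} (w : Fin N → ℂ) : ℂ :=
  ∏ p ∈ Finset.univ.filter (fun p : Fin N × Fin N => p.1 < p.2), (w p.1 - w p.2)

/-- The Schur polynomial `s_λ(v) = det[v_i^{λ_j+N−j}] / ∏_{i<j}(v_i−v_j)`. -/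
def schur {N : ℕ} (lam : Fin N → ℕ) (v : Fin N → ℂ) : ℂ :=
  Matrix.det (Matrix.of fun i j : Fin N =>
    v i ^ (lam j + (N - 1 - (j : ℕ)))) / vandP v

theorem summable_norm_and_hasSum_prod_apply {N : ℕ} (g : Fin N → ℕ → ℂ)
    (hg : ∀ i, Summable fun n => ‖g i n‖) :
    (Summable fun k : Fin N → ℕ => ‖∏ i, g i (k i)‖) ∧
      HasSum (fun k : Fin N → ℕ => ∏ i, g i (k i)) (∏ i, ∑' n, g i n) := by
  induction N with
  | zero =>
    constructor
    · exact (hasSum_fintype _).summable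
    · simp
  | succ N ih =>
    obtain ⟨hs, ht⟩ := ih (fun i => g i.succ) (fun i => hg i.succ)
    let e : ℕ × (Fin N → ℕ) ≃ (Fin (N + 1) → ℕ) := Fin.consEquiv fun _ => ℕ
    have he : ∀ p : ℕ × (Fin N → ℕ),
        ∏ i, g i (e p i) = g 0 p.1 * ∏ i : Fin N, g i.succ (p.2 i) := fun p => by
      simp [e, Fin.prod_univ_succ, Fin.consEquiv]
    have hnorm := (hg 0).mul_norm hs
    constructor
    · rw [← e.summable_iff]
      exact hnorm.congr fun p => by simp only [Function.comp_apply, he]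
    · rw [← e.hasSum_iff, Fin.prod_univ_succ, ← ht.tsum_eq,
        tsum_mul_tsum_of_summable_norm (hg 0) hs]
      exact hnorm.of_norm.hasSum.congr_fun fun p => by simp only [Function.comp_apply, he]

theorem sum_sign_mul_prod_eq_factorial_mul_det {N : ℕ} (G : Matrix (Fin N) (Fin N) ℂ) :
    ∑ σ : Equiv.Perm (Fin N), ∑ τ : Equiv.Perm (Fin N),
      ((σ.sign : ℤ) : ℂ) * ((τ.sign : ℤ) : ℂ) * ∏ j, G (σ j) (τ j)
      = (N.factorial : ℂ) * G.det := by
  have h : ∀ σ : Equiv.Perm (Fin N), ∑ τ : Equiv.Perm (Fin N),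
      ((σ.sign : ℤ) : ℂ) * ((τ.sign : ℤ) : ℂ) * ∏ j, G (σ j) (τ j) = G.det := fun σ => by
    have h1 := Matrix.det_permute σ G
    rw [← Matrix.det_transpose, Matrix.det_apply'] at h1
    simp only [Matrix.transpose_apply, Matrix.submatrix_apply, id_eq] at h1
    simp_rw [mul_assoc, ← Finset.mul_sum]
    rw [h1, ← mul_assoc]
    rcases Int.units_eq_one_or σ.sign with h2 | h2 <;> simp [h2]
  simp [h, Fintype.card_perm]

/-- The Andréief (continuous Cauchy–Binet) identity for sums over all of `Fin N → ℕ`. -/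
theorem summable_norm_and_hasSum_det_mul_det {N : ℕ} (a b : Fin N → ℕ → ℂ)
    (h : ∀ i j, Summable fun n => ‖a i n * b j n‖) :
    (Summable fun k : Fin N → ℕ =>
      ‖(Matrix.of fun i j => a i (k j)).det * (Matrix.of fun i j => b i (k j)).det‖) ∧
    HasSum (fun k : Fin N → ℕ =>
        (Matrix.of fun i j => a i (k j)).det * (Matrix.of fun i j => b i (k j)).det)
      ((N.factorial : ℂ) * (Matrix.of fun i j => ∑' n, a i n * b j n).det) := by
  have hexp : ∀ k : Fin N → ℕ,
      (Matrix.of fun i j => a i (k j)).det * (Matrix.of fun i j => b i (k j)).det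
      = ∑ σ : Equiv.Perm (Fin N), ∑ τ : Equiv.Perm (Fin N),
        ((σ.sign : ℤ) : ℂ) * ((τ.sign : ℤ) : ℂ) *
          ∏ j, (a (σ j) (k j) * b (τ j) (k j)) := fun k => by
    simp only [Matrix.det_apply', Matrix.of_apply, Finset.sum_mul_sum, Finset.prod_mul_distrib]
    exact Finset.sum_congr rfl fun σ _ => Finset.sum_congr rfl fun τ _ => by ring
  have hterm := fun σ τ : Equiv.Perm (Fin N) =>
    summable_norm_and_hasSum_prod_apply (fun j n => a (σ j) n * b (τ j) n) fun j => h _ _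
  constructor
  · refine Summable.of_nonneg_of_le (fun _ => norm_nonneg _)
      (fun k => ?_) (summable_sum fun σ (_ : σ ∈ Finset.univ) =>
        summable_sum fun τ (_ : τ ∈ Finset.univ) => (hterm σ τ).1)
    rw [hexp]
    refine (norm_sum_le _ _).trans (Finset.sum_le_sum fun σ _ =>
      (norm_sum_le _ _).trans (Finset.sum_le_sum fun τ _ => ?_))
    rcases Int.units_eq_one_or σ.sign with h2 | h2 <;>
      rcases Int.units_eq_one_or τ.sign with h3 | h3 <;> simp [h2, h3]
  · simp_rw [hexp]
    rw [← sum_sign_mul_prod_eq_factorial_mul_det]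
    exact hasSum_sum fun σ _ => hasSum_sum fun τ _ => (hterm σ τ).2.mul_left _

theorem StrictAnti.add_sub_le_fin {N : ℕ} {l : Fin N → ℕ} (hl : StrictAnti l) {i j : Fin N}
    (hij : i ≤ j) : l j + ((j : ℕ) - i) ≤ l i := by
  obtain ⟨j, hj⟩ := j
  induction j with
  | zero =>
    have : i = ⟨0, hj⟩ := le_antisymm hij (Nat.zero_le _)
    simp [this]
  | succ j ih =>
    rcases hij.eq_or_lt with rfl | hlt
    · simp
    · have h1 : i ≤ ⟨j, by omega⟩ := Nat.lt_succ_iff.mp hlt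
      have h2 := ih (by omega) h1
      have h3 : l ⟨j + 1, hj⟩ < l ⟨j, by omega⟩ := hl (Nat.lt_succ_self j)
      have h4 : (i : ℕ) ≤ j := h1
      simp only at h2 ⊢
      omega

/-- The strictly decreasing sequence `λ_j + N - j` attached to a signature. -/
def Sign.shift {N : ℕ} (lam : Sign N) (j : Fin N) : ℕ := lam.1 j + (N - 1 - (j : ℕ))

theorem Sign.shift_strictAnti {N : ℕ} (lam : Sign N) : StrictAnti lam.shift := fun i j hij => by
  have h1 := lam.2 i j hij.le
  have h2 : (i : ℕ) < j := hij
  have h3 := j.2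
  simp only [Sign.shift]
  omega

theorem Sign.shift_injective {N : ℕ} : Function.Injective (Sign.shift (N := N)) :=
  fun lam mu h => Subtype.ext <| funext fun j => by
    have := congrFun h j
    simp only [Sign.shift] at this
    omega

theorem Sign.exists_shift_eq {N : ℕ} {l : Fin N → ℕ} (hl : StrictAnti l) :
    ∃ lam : Sign N, lam.shift = l := by
  refine ⟨⟨fun j => l j - (N - 1 - (j : ℕ)), fun i j hij => ?_⟩, funext fun j => ?_⟩
  · have h1 := hl.add_sub_le_fin hij
    have h2 : (i : ℕ) ≤ j := hij
    have h3 := j.2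
    simp only
    omega
  · have h3 := j.2
    have h1 := hl.add_sub_le_fin (i := j) (j := ⟨N - 1, by omega⟩) (by
      rw [Fin.le_def]
      simp only
      omega)
    simp only [Sign.shift] at h1 ⊢
    omega

theorem Sign.shift_comp_perm_injective {N : ℕ} : Function.Injective
    fun p : Sign N × Equiv.Perm (Fin N) => p.1.shift ∘ p.2 := by
  rintro ⟨lam, σ⟩ ⟨mu, τ⟩ h
  simp only at h
  have h1 : lam = mu := by
    refine Sign.shift_injective ((lam.shift_strictAnti.range_inj mu.shift_strictAnti).1 ?_)
    rw [← σ.surjective.range_comp, h, τ.surjective.range_comp]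
  subst h1
  refine Prod.ext rfl (Equiv.ext fun j => ?_)
  exact lam.shift_strictAnti.injective (congrFun h j)

theorem Sign.exists_shift_comp_perm_eq {N : ℕ} {k : Fin N → ℕ} (hk : Function.Injective k) :
    ∃ (lam : Sign N) (σ : Equiv.Perm (Fin N)), lam.shift ∘ σ = k := by
  let ρ := Tuple.sort (fun j => OrderDual.toDual (k j))
  have hmono : Antitone (k ∘ ρ) := Tuple.monotone_sort (fun j => OrderDual.toDual (k j))
  obtain ⟨lam, hlam⟩ := Sign.exists_shift_eq
    (hmono.strictAnti_of_injective (hk.comp ρ.injective))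
  refine ⟨lam, ρ⁻¹, ?_⟩
  rw [hlam]
  ext j
  simp

/-- The Cauchy–Binet identity for sums over strictly decreasing sequences. -/
theorem Sign.summable_norm_and_hasSum_det_mul_det {N : ℕ} (a b : Fin N → ℕ → ℂ)
    (h : ∀ i j, Summable fun n => ‖a i n * b j n‖) :
    (Summable fun lam : Sign N =>
      ‖(Matrix.of fun i j => a i (lam.shift j)).det *
        (Matrix.of fun i j => b i (lam.shift j)).det‖) ∧
    HasSum (fun lam : Sign N =>
        (Matrix.of fun i j => a i (lam.shift j)).det *
          (Matrix.of fun i j => b i (lam.shift j)).det)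
      (Matrix.of fun i j => ∑' n, a i n * b j n).det := by
  obtain ⟨hs, ht⟩ := _root_.summable_norm_and_hasSum_det_mul_det a b h
  set F : (Fin N → ℕ) → ℂ := fun k =>
    (Matrix.of fun i j => a i (k j)).det * (Matrix.of fun i j => b i (k j)).det with hF
  have hperm : ∀ (k : Fin N → ℕ) (σ : Equiv.Perm (Fin N)), F (k ∘ σ) = F k := fun k σ => by
    have h1 := Matrix.det_permute' σ (Matrix.of fun i j => a i (k j))
    have h2 := Matrix.det_permute' σ (Matrix.of fun i j => b i (k j))
    have h3 : F (k ∘ σ) = ((Matrix.of fun i j => a i (k j)).submatrix id σ).det *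
      ((Matrix.of fun i j => b i (k j)).submatrix id σ).det := rfl
    rw [h3, h1, h2]
    rcases Int.units_eq_one_or σ.sign with h4 | h4 <;> simp [h4, hF]
  have hzero : ∀ k ∉ Set.range fun p : Sign N × Equiv.Perm (Fin N) => p.1.shift ∘ p.2,
      F k = 0 := fun k hk => by
    have hk' : ¬ Function.Injective k := fun hinj =>
      let ⟨lam, σ, hl⟩ := Sign.exists_shift_comp_perm_eq hinj
      hk ⟨(lam, σ), hl⟩
    simp only [Function.Injective, not_forall] at hk'
    obtain ⟨i, j, hij, hne⟩ := hk'
    have h0 : (Matrix.of fun i j => a i (k j)).det = 0 :=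
      Matrix.det_zero_of_column_eq hne fun m => by simp [hij]
    simp [hF, h0]
  have hsum : Summable fun lam : Sign N => ‖F lam.shift‖ := hs.comp_injective Sign.shift_injective
  have hpair := (Sign.shift_comp_perm_injective.hasSum_iff hzero).2 ht
  have hpair' := hpair.prod_fiberwise (g := fun lam => (N.factorial : ℂ) * F lam.shift)
    fun lam => by
      have h1 := hasSum_fintype fun σ : Equiv.Perm (Fin N) => F (lam.shift ∘ σ)
      have h2 : ∑ σ : Equiv.Perm (Fin N), F (lam.shift ∘ σ) = N.factorial * F lam.shift := by
        simp [hperm, Fintype.card_perm]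
      exact h2 ▸ h1
  refine ⟨hsum, ?_⟩
  have hfac : (N.factorial : ℂ) ≠ 0 := Nat.cast_ne_zero.2 N.factorial_ne_zero
  exact (hasSum_mul_left_iff hfac).1 hpair'

theorem vandP_eq_prod_Ioi {N : ℕ} (w : Fin N → ℂ) :
    vandP w = ∏ i, ∏ j ∈ Finset.Ioi i, (w i - w j) := by
  simp_rw [vandP, Finset.prod_filter, Fintype.prod_prod_type, ← Finset.prod_filter,
    Finset.filter_lt_eq_Ioi]

theorem vandP_ne_zero {N : ℕ} {w : Fin N → ℂ} (hw : Function.Injective w) : vandP w ≠ 0 :=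
  Finset.prod_ne_zero_iff.2 fun _ hp =>
    sub_ne_zero.2 fun h => (Finset.mem_filter.1 hp).2.ne (hw h)

theorem prod_prod_erase_sub {N : ℕ} (w : Fin N → ℂ) :
    ∏ l, ∏ m ∈ Finset.univ.erase l, (w l - w m) =
      vandP w * (Matrix.vandermonde w).det := by
  have hsplit : ∀ l : Fin N, ∏ m ∈ Finset.univ.erase l, (w l - w m) =
      (∏ m ∈ Finset.Ioi l, (w l - w m)) * ∏ m ∈ Finset.Iio l, (w l - w m) := fun l => by
    rw [← Finset.prod_union]
    · congr 1
      ext m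
      simp [lt_or_lt_iff_ne, eq_comm]
    · exact Finset.disjoint_left.2 fun m h1 h2 =>
        lt_asymm (Finset.mem_Ioi.1 h1) (Finset.mem_Iio.1 h2)
  simp_rw [hsplit]
  rw [Finset.prod_mul_distrib, vandP_eq_prod_Ioi, Matrix.det_vandermonde]
  congr 1
  exact Finset.prod_comm' fun i j => by simp

/-- The coefficients of the partial fraction expansion of `x ^ (N - 1 - i) / ∏ l, (1 - x * v l)`
in terms of the functions `1 / (1 - x * v l)`. -/
def partialFractionMatrix {N : ℕ} (v : Fin N → ℂ) : Matrix (Fin N) (Fin N) ℂ :=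
  Matrix.of fun l i => (∏ m ∈ Finset.univ.erase l, (v l - v m))⁻¹ * v l ^ (i : ℕ)

theorem det_partialFractionMatrix {N : ℕ} {v : Fin N → ℂ} (hv : Function.Injective v) :
    (partialFractionMatrix v).det = (vandP v)⁻¹ := by
  have h := Matrix.det_mul_column
    (fun l => (∏ m ∈ Finset.univ.erase l, (v l - v m))⁻¹) (Matrix.vandermonde v)
  rw [Finset.prod_inv_distrib, prod_prod_erase_sub] at h
  have h0 : (Matrix.vandermonde v).det ≠ 0 := Matrix.det_vandermonde_ne_zero_iff.2 hv
  have h1 := vandP_ne_zero hv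
  calc (partialFractionMatrix v).det = _ := h
    _ = (vandP v)⁻¹ := by field_simp

theorem pow_eq_sum_partialFractionMatrix {N : ℕ} {v : Fin N → ℂ} (hv : Function.Injective v)
    (i : Fin N) (x : ℂ) :
    x ^ (N - 1 - (i : ℕ)) = ∑ l, partialFractionMatrix v l i *
      ∏ m ∈ Finset.univ.erase l, (1 - x * v m) := by
  suffices h : (fun x : ℂ => x ^ (N - 1 - (i : ℕ))) = fun x => ∑ l,
      partialFractionMatrix v l i * ∏ m ∈ Finset.univ.erase l, (1 - x * v m) from congrFun h x
  refine Continuous.ext_on (dense_compl_singleton (0 : ℂ)) (by fun_prop) (by fun_prop) ?_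
  intro x hx
  have hx0 : x ≠ 0 := hx
  have hlag := Lagrange.eq_interpolate (s := Finset.univ) (v := v)
    (f := (Polynomial.X : Polynomial ℂ) ^ (i : ℕ)) hv.injOn (by simp)
  rw [Lagrange.interpolate_eq_sum] at hlag
  have heval := congrArg (Polynomial.eval x⁻¹) hlag
  simp only [Polynomial.eval_pow, Polynomial.eval_X, Polynomial.eval_finsetSum,
    Polynomial.eval_mul, Polynomial.eval_C, Polynomial.eval_prod, Polynomial.eval_sub] at heval
  have hi : (i : ℕ) + (N - 1 - (i : ℕ)) = N - 1 := by have := i.2; omega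
  have hpow : x ^ (N - 1 - (i : ℕ)) = x ^ (N - 1) * x⁻¹ ^ (i : ℕ) := by
    rw [← congrArg (x ^ ·) hi]
    simp only [pow_add, inv_pow]
    field_simp
  simp only
  rw [hpow, heval, Finset.mul_sum]
  refine Finset.sum_congr rfl fun l _ => ?_
  have hprod : ∏ m ∈ Finset.univ.erase l, (1 - x * v m) =
      x ^ (N - 1) * ∏ m ∈ Finset.univ.erase l, (x⁻¹ - v m) := by
    have hcard : (Finset.univ.erase l).card = N - 1 := by simp
    rw [← hcard, ← Finset.prod_const, ← Finset.prod_mul_distrib]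
    exact Finset.prod_congr rfl fun m _ => by field_simp
  rw [hprod, partialFractionMatrix, Matrix.of_apply]
  ring

theorem pow_mul_inv_prod_eq_sum {N : ℕ} {v : Fin N → ℂ} (hv : Function.Injective v)
    (i : Fin N) (x : ℂ) (hx : ∀ l, 1 - x * v l ≠ 0) :
    x ^ (N - 1 - (i : ℕ)) * (∏ l, (1 - x * v l))⁻¹ =
      ∑ l, (1 - x * v l)⁻¹ * partialFractionMatrix v l i := by
  rw [pow_eq_sum_partialFractionMatrix hv i x, Finset.sum_mul]
  refine Finset.sum_congr rfl fun l _ => ?_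
  have h1 : ∏ m ∈ Finset.univ.erase l, (1 - x * v m) ≠ 0 :=
    Finset.prod_ne_zero_iff.2 fun m _ => hx m
  have h2 := hx l
  rw [← Finset.mul_prod_erase Finset.univ (fun l => 1 - x * v l) (Finset.mem_univ l)]
  field_simp

theorem one_sub_ne_zero_of_norm_lt_one {z : ℂ} (hz : ‖z‖ < 1) : 1 - z ≠ 0 := fun h => by
  rw [← sub_eq_zero.1 h, norm_one] at hz
  exact lt_irrefl _ hz

theorem norm_mul_lt_one_of_lt {q : ℝ} (hq0 : 0 < q) (hq1 : q < 1) {z : ℂ} (hz : ‖z‖ < 1) :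
    ‖(q : ℂ) * z‖ < 1 := by
  rw [norm_mul, Complex.norm_real, Real.norm_of_nonneg hq0.le]
  exact mul_lt_one_of_nonneg_of_lt_one_left hq0.le hq1 hz.le

theorem refined_kernel_eq {q : ℝ} (hq0 : 0 < q) (hq1 : q < 1) (γ : ℂ) {z : ℂ} (hz : ‖z‖ < 1) :
    (1 - (q : ℂ) + q * (1 - γ) * (1 - z)) / ((1 - z) * (1 - q * z)) =
      (1 - z)⁻¹ - γ * q * (1 - q * z)⁻¹ := by
  have h1 := one_sub_ne_zero_of_norm_lt_one hz
  have h2 := one_sub_ne_zero_of_norm_lt_one (norm_mul_lt_one_of_lt hq0 hq1 hz)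
  field_simp
  ring

theorem refined_geometric_series {q : ℝ} (hq0 : 0 < q) (hq1 : q < 1) (γ : ℂ) {z : ℂ}
    (hz : ‖z‖ < 1) :
    (Summable fun n : ℕ => ‖(1 - γ * (q : ℂ) ^ (n + 1)) * z ^ n‖) ∧
      ∑' n : ℕ, (1 - γ * (q : ℂ) ^ (n + 1)) * z ^ n =
        (1 - (q : ℂ) + q * (1 - γ) * (1 - z)) / ((1 - z) * (1 - q * z)) := by
  have hqz := norm_mul_lt_one_of_lt hq0 hq1 hz
  have hexp : ∀ n : ℕ, (1 - γ * (q : ℂ) ^ (n + 1)) * z ^ n =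
      z ^ n - γ * q * (q * z) ^ n := fun n => by
    rw [mul_pow]
    ring
  simp_rw [hexp]
  constructor
  · refine Summable.of_nonneg_of_le (fun _ => norm_nonneg _) (fun n => norm_sub_le _ _)
      ((summable_norm_geometric_of_norm_lt_one hz).add ?_)
    simp_rw [norm_mul (γ * (q : ℂ))]
    exact (summable_norm_geometric_of_norm_lt_one hqz).mul_left _
  · rw [refined_kernel_eq hq0 hq1 γ hz]
    exact ((hasSum_geometric_of_norm_lt_one hz).sub
      ((hasSum_geometric_of_norm_lt_one hqz).mul_left _)).tsum_eq

/-- Refined Cauchy identity for Schur polynomials in determinantal form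
(equations (6.9)–(6.10), the `s₀ = 0` specialization of the main results). -/
theorem refined_cauchy_schur
    (N : ℕ) (hN : 1 ≤ N)
    (q : ℝ) (hq0 : 0 < q) (hq1 : q < 1) (γ : ℂ)
    (u v : Fin N → ℂ) (hu : Function.Injective u) (hv : Function.Injective v)
    (huv : ∀ i j : Fin N, ‖u i * v j‖ < 1) :
    Summable (fun lam : Sign N =>
      ‖(∏ j : Fin N, (1 - γ * (q : ℂ) ^ (lam.1 j + (N - 1 - (j : ℕ)) + 1)))
          * schur lam.1 u * schur lam.1 v‖)
    ∧ (∑' lam : Sign N,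
        (∏ j : Fin N, (1 - γ * (q : ℂ) ^ (lam.1 j + (N - 1 - (j : ℕ)) + 1)))
          * schur lam.1 u * schur lam.1 v)
      = Matrix.det (Matrix.of fun i j : Fin N =>
          (1 - (q : ℂ) + q * (1 - γ) * (1 - u i * v j))
            / ((1 - u i * v j) * (1 - q * u i * v j)))
        / (vandP u * vandP v)
    ∧ (∑' lam : Sign N,
        (∏ j : Fin N, (1 - γ * (q : ℂ) ^ (lam.1 j + (N - 1 - (j : ℕ)) + 1)))
          * schur lam.1 u * schur lam.1 v)
      = (1 / vandP u)
          * Matrix.det (Matrix.of fun i j : Fin N =>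
              u j ^ (N - 1 - (i : ℕ))
                * ((∏ l : Fin N, (1 - u j * v l))⁻¹
                    - γ * (q : ℂ) ^ (N - (i : ℕ))
                        * (∏ l : Fin N, (1 - (q : ℂ) * u j * v l))⁻¹)) := by
  set G : Matrix (Fin N) (Fin N) ℂ := Matrix.of fun i j : Fin N =>
    (1 - (q : ℂ) + q * (1 - γ) * (1 - u i * v j))
      / ((1 - u i * v j) * (1 - q * u i * v j)) with hG
  have hterm : ∀ lam : Sign N,
      (∏ j : Fin N, (1 - γ * (q : ℂ) ^ (lam.1 j + (N - 1 - (j : ℕ)) + 1)))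
          * schur lam.1 u * schur lam.1 v =
        (Matrix.of fun i j => (1 - γ * (q : ℂ) ^ (lam.shift j + 1)) * u i ^ lam.shift j).det *
          (Matrix.of fun i j => v i ^ lam.shift j).det * (vandP u * vandP v)⁻¹ := fun lam => by
    have h := Matrix.det_mul_row (fun j => 1 - γ * (q : ℂ) ^ (lam.shift j + 1))
      (Matrix.of fun i j => u i ^ lam.shift j)
    simp only [Matrix.of_apply] at h
    rw [h]
    simp only [schur, Sign.shift, div_eq_mul_inv, mul_inv]
    ring
  have hser := fun i j : Fin N => refined_geometric_series hq0 hq1 γ (huv i j)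
  have hpow : ∀ (i j : Fin N) (n : ℕ), (1 - γ * (q : ℂ) ^ (n + 1)) * u i ^ n * v j ^ n =
      (1 - γ * (q : ℂ) ^ (n + 1)) * (u i * v j) ^ n := fun i j n => by rw [mul_pow, mul_assoc]
  obtain ⟨hs, ht⟩ := Sign.summable_norm_and_hasSum_det_mul_det
    (fun i n => (1 - γ * (q : ℂ) ^ (n + 1)) * u i ^ n) (fun i n => v i ^ n)
    (fun i j => by simpa only [hpow] using (hser i j).1)
  have hdet : (Matrix.of fun i j : Fin N =>
      ∑' n, (1 - γ * (q : ℂ) ^ (n + 1)) * u i ^ n * v j ^ n) = G := by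
    ext i j
    simp only [Matrix.of_apply, hG, hpow, (hser i j).2, mul_assoc]
  rw [hdet] at ht
  have htsum : (∑' lam : Sign N,
        (∏ j : Fin N, (1 - γ * (q : ℂ) ^ (lam.1 j + (N - 1 - (j : ℕ)) + 1)))
          * schur lam.1 u * schur lam.1 v) = G.det / (vandP u * vandP v) := by
    simp_rw [hterm]
    exact (ht.mul_right _).tsum_eq
  refine ⟨?_, htsum, ?_⟩
  · simp_rw [hterm, norm_mul _ ((vandP u * vandP v)⁻¹)]
    exact hs.mul_right _
  · have hfactor : (Matrix.of fun i j : Fin N =>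
        u j ^ (N - 1 - (i : ℕ))
          * ((∏ l : Fin N, (1 - u j * v l))⁻¹
              - γ * (q : ℂ) ^ (N - (i : ℕ))
                  * (∏ l : Fin N, (1 - (q : ℂ) * u j * v l))⁻¹)) =
        (G * partialFractionMatrix v).transpose := by
      ext i j
      have h1 := pow_mul_inv_prod_eq_sum hv i (u j)
        fun l => one_sub_ne_zero_of_norm_lt_one (huv j l)
      have h2 := pow_mul_inv_prod_eq_sum hv i (q * u j) fun l => by
        rw [mul_assoc]
        exact one_sub_ne_zero_of_norm_lt_one (norm_mul_lt_one_of_lt hq0 hq1 (huv j l))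
      have hexp : N - (i : ℕ) = (N - 1 - (i : ℕ)) + 1 := by have := i.2; omega
      have hentry : ∀ l, G j l = (1 - u j * v l)⁻¹ - γ * q * (1 - q * u j * v l)⁻¹ := fun l => by
        have h := refined_kernel_eq hq0 hq1 γ (huv j l)
        simp only [← mul_assoc] at h
        simp only [hG, Matrix.of_apply, h]
      rw [Matrix.transpose_apply, Matrix.mul_apply]
      simp_rw [hentry, sub_mul, Finset.sum_sub_distrib, mul_assoc (γ * (q : ℂ)),
        ← Finset.mul_sum]
      rw [← h1, ← h2, Matrix.of_apply, hexp, mul_pow]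
      ring
    rw [htsum, hfactor, Matrix.det_transpose, Matrix.det_mul, det_partialFractionMatrix hv]
    simp only [div_eq_mul_inv, mul_inv]
    ring
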